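/- Let X and Y be Polish spaces, f : X → Y a Borel map that is countable-to-one (every fiber f^{-1}(y) is countable), and A ⊆ X a Borel set. Then f(A) is a Borel subset of Y. -/

import Mathlib

open Set Filter Topology MeasureTheory TopologicalSpace

def LNSmall {X Y : Type*} [MeasurableSpace X] (f : X → Y) (S : Set (Set X)) : Prop :=
  S.Countable ∧ ∀ s ∈ S, MeasurableSet s ∧ InjOn f s

def LNGood {X Y : Type*} [MeasurableSpace X] (f : X → Y) (n : ℕ) (U : ℕ → Set X) : Prop :=
  ∀ S, LNSmall f S → ∃ y, ∀ j ≤ n, ∃ x ∈ U j, x ∉ ⋃₀ S ∧ f x = y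

theorem ln_borel_hull {X Y : Type*}
    [TopologicalSpace X] [PolishSpace X] [MeasurableSpace X] [BorelSpace X]
    [TopologicalSpace Y] [PolishSpace Y] [MeasurableSpace Y] [BorelSpace Y]
    {f : X → Y} (hf : Continuous f) {A : Set X} (hA : AnalyticSet A) (hinj : InjOn f A) :
    ∃ B, A ⊆ B ∧ MeasurableSet B ∧ InjOn f B := by
  obtain ⟨b, b_count, -, hb⟩ := exists_countable_basis X
  have hbc : Countable b := b_count.to_subtype
  have inter_an : ∀ V : Set X, IsOpen V → AnalyticSet (A ∩ V) := by
    intro V hV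
    rw [inter_eq_iInter]
    refine AnalyticSet.iInter ?_
    rintro (_ | _)
    · exact hV.measurableSet.analyticSet
    · exact hA
  have sep : ∀ p : {p : b × b // Disjoint p.1.1 p.2.1},
      MeasurablySeparable (f '' (A ∩ p.1.1.1)) (f '' (A ∩ p.1.2.1)) := by
    rintro ⟨⟨V, W⟩, hVW⟩
    refine AnalyticSet.measurablySeparable
      ((inter_an _ (hb.isOpen V.2)).image_of_continuous hf)
      ((inter_an _ (hb.isOpen W.2)).image_of_continuous hf) ?_
    rw [Set.disjoint_left]
    rintro y ⟨x, hx, rfl⟩ ⟨x', hx', h⟩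
    have := hinj hx'.1 hx.1 h
    subst this
    exact Set.disjoint_left.1 hVW hx.2 hx'.2
  choose D hD1 hD2 hD3 using sep
  refine ⟨⋂ p, ((p.1.1.1)ᶜ ∪ f ⁻¹' (D p)) ∩ ((p.1.2.1)ᶜ ∪ (f ⁻¹' (D p))ᶜ), ?_, ?_, ?_⟩
  · intro x hx
    refine mem_iInter.2 fun p => ⟨?_, ?_⟩
    · by_cases h : x ∈ p.1.1.1
      · exact Or.inr (hD1 p ⟨x, ⟨hx, h⟩, rfl⟩)
      · exact Or.inl h
    · by_cases h : x ∈ p.1.2.1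
      · exact Or.inr fun h' => Set.disjoint_left.1 (hD2 p) ⟨x, ⟨hx, h⟩, rfl⟩ h'
      · exact Or.inl h
  · refine MeasurableSet.iInter fun p => ?_
    have h1 := (hb.isOpen p.1.1.2).measurableSet
    have h2 := (hb.isOpen p.1.2.2).measurableSet
    have h3 := hf.measurable (hD3 p)
    exact (h1.compl.union h3).inter (h2.compl.union h3.compl)
  · intro x hx x' hx' hxx
    by_contra hne
    obtain ⟨V, W, hV, hW, xV, xW, hVW⟩ := t2_separation hne
    obtain ⟨V', hV'b, xV', hV'⟩ := hb.exists_subset_of_mem_open xV hV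
    obtain ⟨W', hW'b, xW', hW'⟩ := hb.exists_subset_of_mem_open xW hW
    let p : {p : b × b // Disjoint p.1.1 p.2.1} :=
      ⟨(⟨V', hV'b⟩, ⟨W', hW'b⟩), hVW.mono hV' hW'⟩
    have h1 := (mem_iInter.1 hx p).1
    have h2 := (mem_iInter.1 hx' p).2
    rcases h1 with h1 | h1
    · exact h1 xV'
    rcases h2 with h2 | h2
    · exact h2 xW'
    · apply h2
      change f x' ∈ D p
      rw [← hxx]
      exact h1

theorem ln_step {X Y : Type*}
    [MetricSpace X] [PolishSpace X] [MeasurableSpace X] [BorelSpace X]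
    [TopologicalSpace Y] [PolishSpace Y] [MeasurableSpace Y] [BorelSpace Y]
    {f : X → Y} (hf : Continuous f) (n : ℕ) (U : ℕ → Set X) (hU : ∀ j, IsOpen (U j))
    (hG : LNGood f n U) (i : ℕ) (hi : i ≤ n) (ε : ℝ) (hε : 0 < ε) :
    ∃ U' : ℕ → Set X, (∀ j, IsOpen (U' j)) ∧ LNGood f (n+1) U' ∧
      (∀ j ≤ n, closure (U' j) ⊆ U j) ∧ U' (n+1) ⊆ U i ∧
      (∀ j ≤ n+1, ∀ x ∈ U' j, ∀ y ∈ U' j, dist x y < ε) ∧ Disjoint (U' i) (U' (n+1)) := by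
  classical
  obtain ⟨b, b_count, -, hb⟩ := exists_countable_basis X
  have hbc : Countable b := b_count.to_subtype
  let ext : (Fin (n+2) → b) → ℕ → Set X := fun q j => if h : j < n+2 then q ⟨j, h⟩ else univ
  have hext : ∀ q j, IsOpen (ext q j) := by
    intro q j
    by_cases h : j < n + 2
    · simp only [ext, h, dif_pos]; exact hb.isOpen (q _).2
    · simp [ext, h]
  by_contra hcon
  have key : ∀ q : Fin (n+2) → b, ∃ S, LNSmall f S ∧ (((∀ j ≤ n, closure (ext q j) ⊆ U j) ∧
      ext q (n+1) ⊆ U i ∧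
      (∀ j ≤ n+1, ∀ x ∈ ext q j, ∀ y ∈ ext q j, dist x y < ε) ∧
        Disjoint (ext q i) (ext q (n+1))) →
      ¬ ∃ y, ∀ j ≤ n+1, ∃ x ∈ ext q j, x ∉ ⋃₀ S ∧ f x = y) := by
    intro q
    by_cases hq : LNGood f (n+1) (ext q)
    · refine ⟨∅, ⟨countable_empty, by simp⟩, fun h => ?_⟩
      exact (hcon ⟨ext q, hext q, hq, h.1, h.2.1, h.2.2.1, h.2.2.2⟩).elim
    · simp only [LNGood, not_forall] at hq
      obtain ⟨S, hS, h⟩ := hq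
      exact ⟨S, hS, fun _ => h⟩
  choose S hS hSq using key
  let T : Set (Set X) := ⋃ q, S q
  have hT : LNSmall f T := by
    refine ⟨countable_iUnion fun q => (hS q).1, ?_⟩
    intro s hs
    obtain ⟨q, hq⟩ := mem_iUnion.1 hs
    exact (hS q).2 s hq
  have hTm : MeasurableSet (⋃₀ T) := MeasurableSet.sUnion hT.1 fun s hs => (hT.2 s hs).1
  have hUm : ∀ j, MeasurableSet (U j \ ⋃₀ T) := fun j => (hU j).measurableSet.diff hTm
  let C : Option (Fin (n+1)) → Set X := fun o =>
    o.elim (U i \ ⋃₀ T) (fun j => f ⁻¹' (f '' (U j \ ⋃₀ T)))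
  have hC : AnalyticSet (⋂ o, C o) := by
    refine AnalyticSet.iInter ?_
    rintro (_ | j)
    · exact (hUm i).analyticSet
    · exact ((hUm j).analyticSet.image_of_continuous hf).preimage hf
  have hCinj : InjOn f (⋂ o, C o) := by
    intro x hx x' hx' hxx
    by_contra hne
    have hxi : x ∈ U i \ ⋃₀ T := mem_iInter.1 hx none
    have hxi' : x' ∈ U i \ ⋃₀ T := mem_iInter.1 hx' none
    have hxj : ∀ j, ∃ w, j ≤ n → w ∈ U j \ ⋃₀ T ∧ f w = f x := by
      intro j
      by_cases hj : j ≤ n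
      · obtain ⟨w, hw, hw'⟩ : x ∈ f ⁻¹' (f '' (U j \ ⋃₀ T)) :=
          mem_iInter.1 hx (some ⟨j, Nat.lt_succ_of_le hj⟩)
        exact ⟨w, fun _ => ⟨hw, hw'⟩⟩
      · exact ⟨x, fun h => (hj h).elim⟩
    choose w hw using hxj
    obtain ⟨N, N', hN, hN', xN, xN', hNN⟩ := t2_separation hne
    let z : ℕ → X := fun j => if j = n+1 then x' else if j = i then x else w j
    let V : ℕ → Set X := fun j => if j = n+1 then U i ∩ N' else if j = i then U i ∩ N else U j
    have hV : ∀ j, IsOpen (V j) := by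
      intro j
      simp only [V]
      split_ifs
      · exact (hU i).inter hN'
      · exact (hU i).inter hN
      · exact hU j
    have hz : ∀ j ≤ n+1, z j ∈ V j ∧ z j ∉ ⋃₀ T ∧ f (z j) = f x := by
      intro j hj
      simp only [z, V]
      split_ifs with h1 h2
      · exact ⟨⟨hxi'.1, xN'⟩, hxi'.2, hxx.symm⟩
      · exact ⟨⟨hxi.1, xN⟩, hxi.2, rfl⟩
      · have := hw j (by omega)
        exact ⟨this.1.1, this.1.2, this.2⟩
    have hq : ∀ j : Fin (n+2), ∃ t : b, z j ∈ t.1 ∧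
        closure t.1 ⊆ V j ∩ Metric.ball (z j) (ε/2) := by
      intro j
      obtain ⟨t, htb, h1, h2⟩ := hb.exists_closure_subset
        (x := z j) (s := V j ∩ Metric.ball (z j) (ε/2))
        (inter_mem ((hV j).mem_nhds (hz j (by omega)).1) (Metric.ball_mem_nhds _ (by positivity)))
      exact ⟨⟨t, htb⟩, h1, h2⟩
    choose q hq1 hq2 using hq
    have he : ∀ j ≤ n+1, z j ∈ ext q j ∧ closure (ext q j) ⊆ V j ∩ Metric.ball (z j) (ε/2) := by
      intro j hj
      have h : j < n + 2 := by omega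
      simp only [ext, h, dif_pos]
      exact ⟨hq1 ⟨j, h⟩, hq2 ⟨j, h⟩⟩
    have hVn : V (n+1) = U i ∩ N' := by simp [V]
    have hVi : V i = U i ∩ N := by
      have : i ≠ n+1 := by omega
      simp [V, this]
    have heV : ∀ j ≤ n+1, ext q j ⊆ V j := fun j hj =>
      subset_closure.trans ((he j hj).2.trans inter_subset_left)
    refine hSq q ⟨?_, ?_, ?_, ?_⟩ ⟨f x, ?_⟩
    · intro j hj
      refine ((he j (by omega)).2.trans inter_subset_left).trans ?_
      have : j ≠ n+1 := by omega
      by_cases hji : j = i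
      · subst hji; rw [hVi]; exact inter_subset_left
      · simp [V, this, hji]
    · refine (heV _ le_rfl).trans ?_
      rw [hVn]; exact inter_subset_left
    · intro j hj u hu v hv
      have h1 := ((he j hj).2 (subset_closure hu)).2
      have h2 := ((he j hj).2 (subset_closure hv)).2
      rw [Metric.mem_ball] at h1 h2
      have := dist_triangle_right u v (z j)
      linarith
    · refine hNN.mono ?_ ?_
      · refine (heV i (by omega)).trans ?_
        rw [hVi]; exact inter_subset_right
      · refine (heV _ le_rfl).trans ?_
        rw [hVn]; exact inter_subset_right
    · intro j hj
      refine ⟨z j, (he j hj).1, fun h => (hz j hj).2.1 ?_, (hz j hj).2.2⟩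
      exact sUnion_subset_sUnion (subset_iUnion S q) h
  obtain ⟨B, hAB, hB, hBinj⟩ := ln_borel_hull hf hC hCinj
  obtain ⟨y, hy⟩ := hG (insert B T) ⟨hT.1.insert B, by
    rintro s (rfl | hs)
    · exact ⟨hB, hBinj⟩
    · exact hT.2 s hs⟩
  have hsub : ⋃₀ T ⊆ ⋃₀ (insert B T) := sUnion_subset_sUnion (subset_insert _ _)
  obtain ⟨x, hxU, hxT, hxy⟩ := hy i hi
  apply hxT
  refine ⟨B, mem_insert _ _, hAB (mem_iInter.2 ?_)⟩
  rintro (_ | j)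
  · exact ⟨hxU, fun h => hxT (hsub h)⟩
  · obtain ⟨x', hxU', hxT', hxy'⟩ := hy j (by omega)
    exact ⟨x', ⟨hxU', fun h => hxT' (hsub h)⟩, hxy'.trans hxy.symm⟩

theorem ln_cover {X Y : Type*}
    [TopologicalSpace X] [PolishSpace X] [MeasurableSpace X] [BorelSpace X]
    [TopologicalSpace Y] [PolishSpace Y] [MeasurableSpace Y] [BorelSpace Y]
    {f : X → Y} (hf : Continuous f) (hfib : ∀ y : Y, (f ⁻¹' {y}).Countable) :
    ∃ S, LNSmall f S ∧ ⋃₀ S = univ := by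
  letI := upgradeIsCompletelyMetrizable X
  by_contra hcon
  push Not at hcon
  let St := {p : ℕ × (ℕ → Set X) // (∀ j, IsOpen (p.2 j)) ∧ LNGood f p.1 p.2}
  have h0 : LNGood f 0 (fun _ => univ) := by
    intro S hS
    obtain ⟨x, hx⟩ := (ne_univ_iff_exists_notMem _).1 (hcon S hS)
    exact ⟨f x, fun j _ => ⟨x, mem_univ _, hx, rfl⟩⟩
  have step : ∀ n (U : {U : ℕ → Set X // (∀ j, IsOpen (U j)) ∧ LNGood f n U}),
      ∃ U' : {U : ℕ → Set X // (∀ j, IsOpen (U j)) ∧ LNGood f (n+1) U},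
      (∀ j ≤ n, closure (U'.1 j) ⊆ U.1 j) ∧ U'.1 (n+1) ⊆ U.1 n.unpair.1 ∧
      (∀ j ≤ n+1, ∀ x ∈ U'.1 j, ∀ y ∈ U'.1 j, dist x y < (1/2 : ℝ)^n) ∧
      Disjoint (U'.1 n.unpair.1) (U'.1 (n+1)) := by
    rintro n ⟨U, hU, hG⟩
    obtain ⟨U', h1, h2, h3⟩ := ln_step hf n U hU hG n.unpair.1 (Nat.unpair_left_le n)
      ((1/2 : ℝ)^n) (by positivity)
    exact ⟨⟨U', h1, h2⟩, h3⟩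
  choose F hF1 hF2 hF3 hF4 using step
  let P : ∀ n, {U : ℕ → Set X // (∀ j, IsOpen (U j)) ∧ LNGood f n U} := fun n =>
    Nat.rec ⟨fun _ => univ, fun _ => isOpen_univ, h0⟩ (fun n U => F n U) n
  let U : ℕ → ℕ → Set X := fun n => (P n).1
  have hU1 : ∀ n, ∀ j ≤ n, closure (U (n+1) j) ⊆ U n j := fun n => hF1 n (P n)
  have hU2 : ∀ n, U (n+1) (n+1) ⊆ U n n.unpair.1 := fun n => hF2 n (P n)
  have hU3 : ∀ n, ∀ j ≤ n+1, ∀ x ∈ U (n+1) j, ∀ y ∈ U (n+1) j, dist x y < (1/2 : ℝ)^n :=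
    fun n => hF3 n (P n)
  have hU4 : ∀ n, Disjoint (U (n+1) n.unpair.1) (U (n+1) (n+1)) := fun n => hF4 n (P n)
  have hcfg : ∀ n, ∃ y, ∀ j, ∃ x, j ≤ n → x ∈ U n j ∧ f x = y := by
    intro n
    obtain ⟨y, hy⟩ := (P n).2.2 ∅ ⟨countable_empty, by simp⟩
    obtain ⟨x0, -⟩ := hy 0 (Nat.zero_le _)
    refine ⟨y, fun j => ?_⟩
    by_cases hj : j ≤ n
    · obtain ⟨x, hx, -, hxy⟩ := hy j hj
      exact ⟨x, fun _ => ⟨hx, hxy⟩⟩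
    · exact ⟨x0, fun h => (hj h).elim⟩
  choose y x hx using hcfg
  have hmono : ∀ j n m, j ≤ n → n ≤ m → U m j ⊆ U n j := by
    intro j n m hj hnm
    induction m, hnm using Nat.le_induction with
    | base => exact subset_rfl
    | succ m hm ih => exact (subset_closure.trans (hU1 m j (hj.trans hm))).trans ih
  have hpow : Tendsto (fun n : ℕ => (1/2 : ℝ)^n) atTop (𝓝 0) :=
    tendsto_pow_atTop_nhds_zero_of_lt_one (by norm_num) (by norm_num)
  have hlim : ∀ j, ∃ q, Tendsto (fun n => x n j) atTop (𝓝 q) := by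
    intro j
    apply cauchySeq_tendsto_of_complete
    rw [Metric.cauchySeq_iff]
    intro ε hε
    obtain ⟨N, hN⟩ := ((tendsto_order.1 hpow).2 ε hε).exists
    refine ⟨max N j + 1, fun m hm m' hm' => ?_⟩
    have hsub : ∀ m ≥ max N j + 1, x m j ∈ U (max N j + 1) j := fun m hm =>
      hmono j _ _ (by omega) hm (hx m j (by omega)).1
    refine (hU3 (max N j) j (by omega) _ (hsub m hm) _ (hsub m' hm')).trans_le ?_
    exact (pow_le_pow_of_le_one (by norm_num) (by norm_num) (le_max_left _ _)).trans hN.le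
  choose q hq using hlim
  have hqU : ∀ j n, j ≤ n → q j ∈ U n j := by
    intro j n hj
    apply hU1 n j hj
    refine mem_closure_of_tendsto (hq j) ?_
    filter_upwards [eventually_ge_atTop (n+1)] with m hm
    exact hmono j _ _ (by omega) hm (hx m j (by omega)).1
  have hfy : ∀ j, Tendsto y atTop (𝓝 (f (q j))) := by
    intro j
    refine ((hf.tendsto _).comp (hq j)).congr' ?_
    filter_upwards [eventually_ge_atTop j] with m hm
    exact (hx m j hm).2
  have hfq : ∀ j, f (q j) = f (q 0) := fun j => tendsto_nhds_unique (hfy j) (hfy 0)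
  have hpre : Preperfect (range q) := by
    rw [preperfect_iff_nhds]
    rintro _ ⟨i, rfl⟩ W hW
    obtain ⟨ε, hε, hball⟩ := Metric.mem_nhds_iff.1 hW
    obtain ⟨N, hN⟩ := ((tendsto_order.1 hpow).2 ε hε).exists
    let n := Nat.pair i (N+1)
    have hn : N + 1 ≤ n := Nat.right_le_pair _ _
    have hni : i ≤ n := Nat.left_le_pair _ _
    have hun : n.unpair.1 = i := by simp [n]
    obtain ⟨k, hk⟩ : ∃ k, n = k + 1 := ⟨n - 1, by omega⟩
    refine ⟨q (n+1), ⟨hball ?_, mem_range_self _⟩, ?_⟩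
    · have h1 : q (n+1) ∈ U n i := by
        have := hU2 n (hqU (n+1) (n+1) le_rfl)
        rwa [hun] at this
      have h2 := hqU i n hni
      have h3 := hU3 k i (by omega)
      rw [← hk] at h3
      rw [Metric.mem_ball]
      refine (h3 _ h1 _ h2).trans_le ?_
      exact (pow_le_pow_of_le_one (by norm_num) (by norm_num) (by omega)).trans hN.le
    · intro h
      have hd := hU4 n
      rw [hun] at hd
      refine Set.disjoint_left.1 hd (hqU i (n+1) (by omega)) ?_
      rw [← h]
      exact hqU (n+1) (n+1) le_rfl
  have hperf := hpre.perfect_closure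
  obtain ⟨g, hg, -, hginj⟩ := hperf.exists_nat_bool_injection ⟨q 0, subset_closure (mem_range_self 0)⟩
  have hsub : closure (range q) ⊆ f ⁻¹' {f (q 0)} := by
    refine closure_minimal ?_ (isClosed_singleton.preimage hf)
    rintro _ ⟨j, rfl⟩
    exact hfq j
  have hc : (range g).Countable := (hfib (f (q 0))).mono (hg.trans hsub)
  have : Countable (ℕ → Bool) := by
    rw [← Set.countable_univ_iff]
    rw [← image_univ] at hc
    exact Set.countable_of_injective_of_countable_image hginj.injOn hc
  have h1 := Cardinal.mk_le_aleph0 (α := ℕ → Bool)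
  have h2 := Cardinal.cantor Cardinal.aleph0
  simp only [Cardinal.mk_pi, Cardinal.prod_const, Cardinal.mk_bool, Cardinal.mk_nat,
    Cardinal.lift_id, Cardinal.lift_aleph0, Cardinal.lift_ofNat] at h1
  exact absurd h1 (not_le.2 h2)

/-- Lusin–Novikov: if `X` and `Y` are Polish spaces, `f : X → Y` is a Borel map all
of whose fibers are countable, and `A ⊆ X` is Borel, then `f(A)` is Borel in `Y`. -/
theorem borel_image_of_countable_to_one {X Y : Type*}
    [TopologicalSpace X] [PolishSpace X] [MeasurableSpace X] [BorelSpace X]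
    [TopologicalSpace Y] [PolishSpace Y] [MeasurableSpace Y] [BorelSpace Y]
    {f : X → Y} (hf : Measurable f) (hfib : ∀ y : Y, (f ⁻¹' {y}).Countable)
    {A : Set X} (hA : MeasurableSet A) :
    MeasurableSet (f '' A) := by
  have hbor : _ = borel X := BorelSpace.measurable_eq (α := X)
  obtain ⟨t', ht', hfc, hpol⟩ := hf.exists_continuous
  have hA' : MeasurableSet[@borel X t'] A := by
    apply borel_anti ht'
    rwa [← hbor]
  clear hf hA
  letI : MeasurableSpace X := @borel X t'
  letI : TopologicalSpace X := t'
  haveI : BorelSpace X := ⟨rfl⟩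
  obtain ⟨S, hS, hcov⟩ := ln_cover hfc hfib
  have : f '' A = ⋃ s ∈ S, f '' (A ∩ s) := by
    rw [← image_iUnion₂, ← inter_iUnion₂, ← sUnion_eq_biUnion, hcov, inter_univ]
  rw [this]
  refine MeasurableSet.biUnion hS.1 fun s hs => ?_
  exact (hA'.inter (hS.2 s hs).1).image_of_continuousOn_injOn hfc.continuousOn
    ((hS.2 s hs).2.mono inter_subset_right)
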